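/- arXiv:2312.04246 — 5 statements merged into one kernel-verified Lean document; each statement's English description precedes it below -/
import Mathlib

section
/- Fix an integer C ≥ 1 and a constant c_1 > 0. Let n = n(ν) and N = N(ν) be sequences of positive integers with N → ∞, c_1 N < n ≤ CN − 1 and CN − n → ∞, and let λ_0 = λ_0(n/N) be the unique positive solution of λ g′(λ)/g(λ) = n/N. Then M_n(N,C) ∼ n! g(λ_0)^N / ( λ_0^n · √(2π N Var(W(λ_0))) ) as ν → ∞. -/
open Filter Finset
open scoped BigOperators Real

/-- Placements of `n` distinguishable balls into `N` distinguishable bins with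
no bin containing more than `C` balls. -/
def validPlacements (n N C : ℕ) : Finset (Fin n → Fin N) :=
  Finset.univ.filter fun f => ∀ j, (Finset.univ.filter fun i => f i = j).card ≤ C

/-- `M_n(N,C)`, the number of such placements. -/
def Mcount (n N C : ℕ) : ℕ := (validPlacements n N C).card

/-- `g(λ) = ∑_{k=0}^C λ^k / k!`. -/
noncomputable def gfun (C : ℕ) (x : ℝ) : ℝ :=
  ∑ k ∈ Finset.range (C + 1), x ^ k / (Nat.factorial k)

/-- Mean of the truncated Poisson random variable `W(λ)`. -/
noncomputable def meanW (C : ℕ) (x : ℝ) : ℝ :=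
  ∑ j ∈ Finset.range (C + 1), (j : ℝ) * (x ^ j / (Nat.factorial j * gfun C x))

/-- Variance of the truncated Poisson random variable `W(λ)`. -/
noncomputable def varW (C : ℕ) (x : ℝ) : ℝ :=
  (∑ j ∈ Finset.range (C + 1), (j : ℝ) ^ 2 * (x ^ j / (Nat.factorial j * gfun C x)))
    - (meanW C x) ^ 2

/-- The number of maps with prescribed fibre sizes is a multinomial coefficient. -/
theorem card_filter_card_fiber_eq {n N : ℕ} (k : Fin N → ℕ) (hk : ∑ j, k j = n) :
    (univ.filter fun f : Fin n → Fin N => ∀ j, (univ.filter fun i => f i = j).card = k j).card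
      = Nat.multinomial univ k := by
  have hprod : ∀ f : Fin n → Fin N,
      ∏ i, (MvPolynomial.X (f i) : MvPolynomial (Fin N) ℕ) = MvPolynomial.monomial
        (Finsupp.equivFunOnFinite.symm fun j => (univ.filter fun i => f i = j).card) 1 := by
    intro f
    rw [MvPolynomial.monomial_eq, Finsupp.prod_fintype _ _ (by simp),
      ← Finset.prod_fiberwise univ f]
    simp only [map_one, one_mul]
    refine prod_congr rfl fun j _ => ?_
    rw [prod_congr rfl (g := fun _ => (MvPolynomial.X j : MvPolynomial (Fin N) ℕ))
      (by simp +contextual)]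
    simp
  have hmon : ∀ l : Fin N → ℕ,
      ∏ j, (MvPolynomial.X j : MvPolynomial (Fin N) ℕ) ^ l j = MvPolynomial.monomial
        (Finsupp.equivFunOnFinite.symm l) 1 := by
    intro l
    rw [MvPolynomial.monomial_eq, Finsupp.prod_fintype _ _ (by simp)]
    simp
  have h1 := Finset.sum_pow_eq_sum_piAntidiag univ
    (fun j : Fin N => (MvPolynomial.X j : MvPolynomial (Fin N) ℕ)) n
  rw [Finset.sum_pow', Fintype.piFinset_univ] at h1
  have h2 := congrArg (MvPolynomial.coeff (Finsupp.equivFunOnFinite.symm k)) h1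
  simp only [hprod, hmon, MvPolynomial.coeff_sum, MvPolynomial.coeff_monomial,
    EmbeddingLike.apply_eq_iff_eq] at h2
  rw [Finset.card_filter]
  simp only [funext_iff] at h2
  rw [h2, Finset.sum_eq_single k]
  · rw [← map_natCast (MvPolynomial.C (σ := Fin N) (R := ℕ)), MvPolynomial.coeff_C_mul]
    simp
  · intro l _ hl
    rw [← map_natCast (MvPolynomial.C (σ := Fin N) (R := ℕ)), MvPolynomial.coeff_C_mul,
      MvPolynomial.coeff_monomial, if_neg (by simpa using hl), mul_zero]
  · intro h
    exact absurd (by simp [hk]) h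

theorem Mcount_eq_sum (n N C : ℕ) :
    (Mcount n N C : ℝ) = n.factorial *
      ∑ k ∈ (Fintype.piFinset fun _ : Fin N => range (C + 1)).filter (fun k => ∑ j, k j = n),
        ∏ j, ((k j).factorial : ℝ)⁻¹ := by
  rw [Mcount, validPlacements, Finset.card_eq_sum_card_fiberwise
    (f := fun (f : Fin n → Fin N) j => (univ.filter fun i => f i = j).card)
    (t := (Fintype.piFinset fun _ : Fin N => range (C + 1)).filter (fun k => ∑ j, k j = n)),
    Nat.cast_sum, mul_sum]
  · refine sum_congr rfl fun k hk => ?_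
    simp only [mem_filter, Fintype.mem_piFinset, mem_range] at hk
    have hfil : ((univ.filter fun f : Fin n → Fin N =>
        ∀ j, (univ.filter fun i => f i = j).card ≤ C).filter
          fun f => (fun j => (univ.filter fun i => f i = j).card) = k) =
        univ.filter fun f : Fin n → Fin N => ∀ j, (univ.filter fun i => f i = j).card = k j := by
      ext f
      simp only [mem_filter, mem_univ, true_and, funext_iff]
      constructor
      · exact fun h => h.2
      · exact fun h => ⟨fun j => by have := hk.1 j; have := h j; omega, h⟩
    rw [hfil, card_filter_card_fiber_eq k hk.2]
    have hspec := Nat.multinomial_spec univ k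
    rw [hk.2] at hspec
    rw [← hspec]
    push_cast
    rw [prod_inv_distrib]
    have : (∏ j, ((k j).factorial : ℝ)) ≠ 0 :=
      prod_ne_zero_iff.2 fun j _ => Nat.cast_ne_zero.2 (Nat.factorial_ne_zero _)
    field_simp
  · intro f hf
    simp only [mem_coe, mem_filter, mem_univ, true_and, Fintype.mem_piFinset, mem_range] at hf ⊢
    refine ⟨fun j => Nat.lt_succ_of_le (hf j), ?_⟩
    rw [← Finset.card_eq_sum_card_fiberwise (f := f) (by simp)]
    simp

theorem integral_exp_int_mul_I (m : ℤ) :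
    ∫ θ in (-π)..π, Complex.exp ((θ : ℂ) * m * Complex.I) = if m = 0 then 2 * (π : ℂ) else 0 := by
  split_ifs with h
  · simp [h]; ring
  · have hc : (m : ℂ) * Complex.I ≠ 0 := mul_ne_zero (by exact_mod_cast h) Complex.I_ne_zero
    have := integral_exp_mul_complex (a := -π) (b := π) hc
    simp_rw [show ∀ θ : ℝ, (θ : ℂ) * m * Complex.I = m * Complex.I * θ from fun θ => by ring]
    rw [this, div_eq_zero_iff]
    left
    rw [sub_eq_zero, Complex.exp_eq_exp_iff_exists_int]
    refine ⟨m, ?_⟩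
    push_cast
    ring

/-- Fourier inversion for the law of a sum of `N` independent copies of a lattice variable. -/
theorem integral_charFun_pow (p : ℕ → ℝ) (C N n : ℕ) (m : ℝ) (hm : N * m = n) :
    ∫ θ in (-π)..π, (∑ j ∈ range (C + 1), (p j : ℂ) *
        Complex.exp (((θ * (j - m) : ℝ) : ℂ) * Complex.I)) ^ N =
      2 * π * ((∑ k ∈ (Fintype.piFinset fun _ : Fin N => range (C + 1)).filter
        (fun k => ∑ j, k j = n), ∏ j, p (k j) : ℝ) : ℂ) := by
  have hm' : (N : ℂ) * m = n := by exact_mod_cast hm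
  have hpt : ∀ (θ : ℝ) (k : Fin N → ℕ),
      ∏ i, (p (k i) : ℂ) * Complex.exp (((θ * (k i - m) : ℝ) : ℂ) * Complex.I) =
        (∏ i, (p (k i) : ℂ)) *
          Complex.exp ((θ : ℂ) * (((∑ i, k i : ℕ) : ℤ) - (n : ℤ) : ℤ) * Complex.I) := by
    intro θ k
    rw [prod_mul_distrib, ← Complex.exp_sum]
    congr 2
    push_cast
    rw [← sum_mul, ← mul_sum, sum_sub_distrib, sum_const, card_univ, Fintype.card_fin,
      nsmul_eq_mul, hm']
  simp_rw [Finset.sum_pow', hpt]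
  rw [intervalIntegral.integral_finsetSum]
  · simp_rw [intervalIntegral.integral_const_mul, integral_exp_int_mul_I, sub_eq_zero, Nat.cast_inj]
    simp only [mul_ite, mul_zero]
    rw [← sum_filter, ← sum_mul]
    push_cast
    ring
  · intro k _
    exact (by fun_prop : Continuous _).intervalIntegrable _ _

/-- The characteristic function, centred at `m`, of the weights `p` on `{0, …, C}`. -/
noncomputable def latticeChar (p : ℕ → ℝ) (C : ℕ) (m θ : ℝ) : ℂ :=
  ∑ j ∈ range (C + 1), (p j : ℂ) * Complex.exp (((θ * (j - m) : ℝ) : ℂ) * Complex.I)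

theorem norm_add_mul_exp_le {a b x y : ℝ} (ha : 0 ≤ a) (hb : 0 ≤ b) (hab : a + b ≤ 1) :
    ‖(a : ℂ) * Complex.exp (x * Complex.I) + b * Complex.exp (y * Complex.I)‖ ≤
      a + b - a * b * (1 - Real.cos (x - y)) := by
  have hcos := Real.cos_le_one (x - y)
  have hcos' := Real.neg_one_le_cos (x - y)
  have hab0 : 0 ≤ a * b := mul_nonneg ha hb
  have hsq : ‖(a : ℂ) * Complex.exp (x * Complex.I) + b * Complex.exp (y * Complex.I)‖ ^ 2 =
      (a + b) ^ 2 - 2 * (a * b * (1 - Real.cos (x - y))) := by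
    rw [← Complex.normSq_eq_norm_sq, Complex.normSq_apply, Real.cos_sub]
    simp only [Complex.add_re, Complex.add_im, Complex.re_ofReal_mul, Complex.im_ofReal_mul,
      Complex.exp_ofReal_mul_I_re, Complex.exp_ofReal_mul_I_im]
    linear_combination a ^ 2 * Real.sin_sq_add_cos_sq x + b ^ 2 * Real.sin_sq_add_cos_sq y
  have hD : 0 ≤ a * b * (1 - Real.cos (x - y)) := mul_nonneg hab0 (by linarith)
  refine (sq_le_sq₀ (norm_nonneg _) ?_).1 ?_
  · nlinarith [mul_nonneg hab0 (by linarith : 0 ≤ 1 + Real.cos (x - y)), mul_nonneg ha hb]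
  · rw [hsq]
    nlinarith [mul_nonneg hD (sub_nonneg.2 hab)]

theorem norm_latticeChar_le {p : ℕ → ℝ} {D : ℕ} {m θ : ℝ} (hp : ∀ j, 0 ≤ p j)
    (hsum : ∑ j ∈ range (D + 1 + 1), p j = 1) (hθ : |θ| ≤ π) :
    ‖latticeChar p (D + 1) m θ‖ ≤ Real.exp (-(2 / π ^ 2 * (p D * p (D + 1)) * θ ^ 2)) := by
  have hrest : 0 ≤ ∑ j ∈ range D, p j := sum_nonneg fun j _ => hp j
  rw [sum_range_succ, sum_range_succ] at hsum
  have hcos := Real.cos_le_one_sub_mul_cos_sq hθ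
  have hpq : 0 ≤ p D * p (D + 1) := mul_nonneg (hp _) (hp _)
  calc ‖latticeChar p (D + 1) m θ‖
      ≤ (∑ j ∈ range D, p j) +
        (p D + p (D + 1) - p D * p (D + 1) * (1 - Real.cos (θ * (D - m) - θ * ((D + 1 : ℕ) - m)))) := by
        rw [latticeChar, sum_range_succ, sum_range_succ, add_assoc]
        refine (norm_add_le _ _).trans (add_le_add ?_ ?_)
        · refine (norm_sum_le _ _).trans (sum_le_sum fun j _ => ?_)
          rw [norm_mul, Complex.norm_exp_ofReal_mul_I, mul_one, Complex.norm_real,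
            Real.norm_of_nonneg (hp j)]
        · exact norm_add_mul_exp_le (hp _) (hp _) (by linarith)
    _ = 1 - p D * p (D + 1) * (1 - Real.cos θ) := by
        rw [show θ * (D - m) - θ * ((D + 1 : ℕ) - m) = -θ by push_cast; ring, Real.cos_neg]
        linarith
    _ ≤ -(2 / π ^ 2 * (p D * p (D + 1)) * θ ^ 2) + 1 := by nlinarith
    _ ≤ _ := Real.add_one_le_exp _

theorem norm_exp_mul_I_sub_taylor_le (x : ℝ) :
    ‖Complex.exp (x * Complex.I) - (1 + x * Complex.I - x ^ 2 / 2)‖ ≤ |x| ^ 3 * Real.exp |x| := by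
  have h := Complex.norm_exp_sub_sum_le_norm_mul_exp (x * Complex.I) 3
  rw [norm_mul, Complex.norm_I, mul_one, Complex.norm_real, Real.norm_eq_abs] at h
  convert h using 3
  simp [sum_range_succ, Nat.factorial, mul_pow]
  ring

theorem norm_latticeChar_sub_le {p : ℕ → ℝ} {C : ℕ} {m v : ℝ} (θ : ℝ) (hp : ∀ j, 0 ≤ p j)
    (hsum : ∑ j ∈ range (C + 1), p j = 1) (hm : ∑ j ∈ range (C + 1), j * p j = m)
    (hv : ∑ j ∈ range (C + 1), p j * (j - m) ^ 2 = v) :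
    ‖latticeChar p C m θ - (1 - θ ^ 2 * v / 2 : ℝ)‖ ≤
      |θ| ^ 3 * C * Real.exp (|θ| * C) * v := by
  have hm0 : 0 ≤ m := hm ▸ sum_nonneg fun j _ => mul_nonneg j.cast_nonneg (hp j)
  have hmC : m ≤ C := by
    rw [← hm, ← mul_one (C : ℝ), ← hsum, mul_sum]
    refine sum_le_sum fun j hj => mul_le_mul_of_nonneg_right ?_ (hp j)
    exact_mod_cast Nat.lt_succ_iff.1 (mem_range.1 hj)
  have hexp : latticeChar p C m θ - (1 - θ ^ 2 * v / 2 : ℝ) =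
      ∑ j ∈ range (C + 1), (p j : ℂ) * (Complex.exp (((θ * (j - m) : ℝ) : ℂ) * Complex.I) -
        (1 + ((θ * (j - m) : ℝ) : ℂ) * Complex.I - ((θ * (j - m) : ℝ) : ℂ) ^ 2 / 2)) := by
    have h1 : ∑ j ∈ range (C + 1), p j * (j - m) = 0 := by
      simp_rw [mul_sub, sum_sub_distrib, ← sum_mul, hsum, mul_comm (p _), hm]
      ring
    have h2 : ∑ j ∈ range (C + 1), (p j : ℂ) *
        (1 + ((θ * (j - m) : ℝ) : ℂ) * Complex.I - ((θ * (j - m) : ℝ) : ℂ) ^ 2 / 2) =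
        ((∑ j ∈ range (C + 1), p j : ℝ) : ℂ) +
          θ * Complex.I * ((∑ j ∈ range (C + 1), p j * (j - m) : ℝ) : ℂ) -
          θ ^ 2 / 2 * ((∑ j ∈ range (C + 1), p j * (j - m) ^ 2 : ℝ) : ℂ) := by
      push_cast
      rw [mul_sum, mul_sum, ← sum_add_distrib, ← sum_sub_distrib]
      refine sum_congr rfl fun j _ => ?_
      ring
    simp_rw [mul_sub (p _ : ℂ) (Complex.exp _)]
    rw [sum_sub_distrib, h2, hsum, h1, hv, latticeChar]
    push_cast
    ring
  rw [hexp]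
  refine (norm_sum_le _ _).trans ?_
  rw [← hv, mul_sum]
  refine sum_le_sum fun j hj => ?_
  have hjC : (j : ℝ) ≤ C := by exact_mod_cast Nat.lt_succ_iff.1 (mem_range.1 hj)
  have habs : |(j : ℝ) - m| ≤ C := abs_le.2 ⟨by linarith [j.cast_nonneg (α := ℝ)], by linarith⟩
  rw [norm_mul, Complex.norm_real, Real.norm_of_nonneg (hp j)]
  calc p j * _ ≤ p j * (|θ * (j - m)| ^ 3 * Real.exp |θ * (j - m)|) :=
        mul_le_mul_of_nonneg_left (norm_exp_mul_I_sub_taylor_le _) (hp j)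
    _ = p j * ((|θ| ^ 3 * |(j : ℝ) - m| * (j - m) ^ 2) * Real.exp (|θ| * |j - m|)) := by
        rw [abs_mul, ← sq_abs ((j : ℝ) - m)]
        ring
    _ ≤ p j * ((|θ| ^ 3 * C * (j - m) ^ 2) * Real.exp (|θ| * C)) := by
        have := hp j
        gcongr
    _ = _ := by ring

theorem norm_pow_sub_pow_le_mul {a b : ℂ} (ha : ‖a‖ ≤ 1) (hb : ‖b‖ ≤ 1) (n : ℕ) :
    ‖a ^ n - b ^ n‖ ≤ n * ‖a - b‖ := by
  induction n with
  | zero => simp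
  | succ n ih =>
    calc ‖a ^ (n + 1) - b ^ (n + 1)‖ = ‖a * (a ^ n - b ^ n) + (a - b) * b ^ n‖ := by
          congr 1; ring
      _ ≤ ‖a‖ * ‖a ^ n - b ^ n‖ + ‖a - b‖ * ‖b‖ ^ n := by
          refine (norm_add_le _ _).trans ?_
          rw [norm_mul, norm_mul, norm_pow]
      _ ≤ 1 * (n * ‖a - b‖) + ‖a - b‖ * 1 := by
          gcongr
          exact pow_le_one₀ (norm_nonneg _) hb
      _ = _ := by push_cast; ring

/-- If `s ^ 2 = N * v` tends to infinity, the rescaled characteristic functions tend to the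
Gaussian one. -/
theorem tendsto_latticeChar_pow {C : ℕ} {p : ℕ → ℕ → ℝ} {m v : ℕ → ℝ} {N : ℕ → ℕ}
    (hp : ∀ ν j, 0 ≤ p ν j)
    (hsum : ∀ ν, ∑ j ∈ range (C + 1), p ν j = 1)
    (hm : ∀ ν, ∑ j ∈ range (C + 1), j * p ν j = m ν)
    (hv : ∀ ν, ∑ j ∈ range (C + 1), p ν j * (j - m ν) ^ 2 = v ν)
    (hN : Tendsto N atTop atTop) (hNv : Tendsto (fun ν => N ν * v ν) atTop atTop) (t : ℝ) :
    Tendsto (fun ν => latticeChar (p ν) C (m ν) (t / √(N ν * v ν)) ^ N ν) atTop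
      (nhds (Real.exp (-(1 / 2) * t ^ 2) : ℂ)) := by
  have hNr : Tendsto (fun ν => (N ν : ℝ)) atTop atTop := tendsto_natCast_atTop_atTop.comp hN
  have hs : Tendsto (fun ν => √(N ν * v ν)) atTop atTop := Real.tendsto_sqrt_atTop.comp hNv
  have hts : Tendsto (fun ν => |t| / √(N ν * v ν)) atTop (nhds 0) := tendsto_const_nhds.div_atTop hs
  have hbound : Tendsto (fun ν => |t| ^ 2 * (|t| / √(N ν * v ν)) * C *
      Real.exp (|t| / √(N ν * v ν) * C) + (t ^ 2 / 2) ^ 2 / N ν) atTop (nhds 0) := by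
    have h1 : Tendsto (fun ν => |t| ^ 2 * (|t| / √(N ν * v ν)) * C *
        Real.exp (|t| / √(N ν * v ν) * C)) atTop (nhds (|t| ^ 2 * 0 * C * Real.exp (0 * C))) :=
      ((hts.const_mul _).mul_const _).mul (Real.continuous_exp.continuousAt.tendsto.comp
        (hts.mul_const _))
    simpa using h1.add (tendsto_const_nhds.div_atTop hNr)
  rw [tendsto_iff_norm_sub_tendsto_zero]
  refine squeeze_zero' (Eventually.of_forall fun _ => norm_nonneg _) ?_ hbound
  filter_upwards [hNv.eventually_gt_atTop 0, hNr.eventually_gt_atTop 0,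
    hNr.eventually_ge_atTop (t ^ 2 / 2)] with ν h0 hN0 hNt
  set s := √(N ν * v ν)
  have hs0 : 0 < s := Real.sqrt_pos.2 h0
  have hs2 : s ^ 2 = N ν * v ν := Real.sq_sqrt h0.le
  have hNne : (N ν : ℝ) ≠ 0 := hN0.ne'
  have hθ : (t / s) ^ 2 * v ν = t ^ 2 / N ν := by
    rw [div_pow, hs2]
    have : v ν ≠ 0 := fun h => by simp [h] at h0
    field_simp
  have hpow : (Real.exp (-(1 / 2) * t ^ 2) : ℂ) =
      ((Real.exp (-(t ^ 2 / 2 / N ν)) : ℝ) : ℂ) ^ N ν := by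
    rw [← Complex.ofReal_pow, ← Real.exp_nat_mul]
    congr 2
    field_simp
  have hφ : ‖latticeChar (p ν) C (m ν) (t / s)‖ ≤ 1 := by
    rw [← hsum ν, latticeChar]
    refine (norm_sum_le _ _).trans (sum_le_sum fun j _ => ?_)
    rw [norm_mul, Complex.norm_exp_ofReal_mul_I, mul_one, Complex.norm_real,
      Real.norm_of_nonneg (hp ν j)]
  have hb : ‖((Real.exp (-(t ^ 2 / 2 / N ν)) : ℝ) : ℂ)‖ ≤ 1 := by
    rw [Complex.norm_real, Real.norm_of_nonneg (Real.exp_pos _).le, Real.exp_le_one_iff]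
    have : 0 ≤ t ^ 2 / 2 / N ν := by positivity
    linarith
  have hT := norm_latticeChar_sub_le (t / s) (hp ν) (hsum ν) (hm ν) (hv ν)
  have hE : ‖((1 - (t / s) ^ 2 * v ν / 2 : ℝ) : ℂ) -
      ((Real.exp (-(t ^ 2 / 2 / N ν)) : ℝ) : ℂ)‖ ≤ (t ^ 2 / 2 / N ν) ^ 2 := by
    rw [← Complex.ofReal_sub, Complex.norm_real, norm_sub_rev, hθ]
    have hn : ‖-(t ^ 2 / 2 / N ν)‖ = t ^ 2 / 2 / N ν := by
      rw [norm_neg, Real.norm_of_nonneg (by positivity)]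
    have h1 := Real.norm_exp_sub_one_sub_id_le (x := -(t ^ 2 / 2 / N ν)) (by
      rw [hn]; exact (div_le_one hN0).2 hNt)
    rw [hn] at h1
    rw [show ∀ y : ℝ, y - (1 - t ^ 2 / N ν / 2) = y - 1 - -(t ^ 2 / 2 / N ν) from
      fun y => by ring]
    exact h1
  rw [hpow]
  refine (norm_pow_sub_pow_le_mul hφ hb _).trans ?_
  calc (N ν : ℝ) * _ ≤ N ν * (|t / s| ^ 3 * C * Real.exp (|t / s| * C) * v ν +
        (t ^ 2 / 2 / N ν) ^ 2) := by
        gcongr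
        exact (norm_sub_le_norm_sub_add_norm_sub _ _ _).trans (add_le_add hT hE)
    _ = _ := by
        rw [abs_div, abs_of_pos hs0]
        have h3 : (N ν : ℝ) * ((|t| / s) ^ 3 * v ν) = |t| ^ 2 * (|t| / s) := by
          rw [show (N ν : ℝ) * ((|t| / s) ^ 3 * v ν) = (N ν * v ν) * (|t| / s) ^ 3 by ring, ← hs2]
          field_simp
        have h4 : (N ν : ℝ) * (t ^ 2 / 2 / N ν) ^ 2 = (t ^ 2 / 2) ^ 2 / N ν := by
          field_simp
        rw [mul_add, h4, ← h3]
        ring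

/-- Local limit theorem in Fourier form for triangular arrays of bounded lattice variables. -/
theorem tendsto_sqrt_mul_integral_latticeChar_pow {D : ℕ} {p : ℕ → ℕ → ℝ} {m v : ℕ → ℝ}
    {N : ℕ → ℕ} {K : ℝ} (hK : 0 < K)
    (hp : ∀ ν j, 0 ≤ p ν j)
    (hsum : ∀ ν, ∑ j ∈ range (D + 1 + 1), p ν j = 1)
    (hm : ∀ ν, ∑ j ∈ range (D + 1 + 1), j * p ν j = m ν)
    (hv : ∀ ν, ∑ j ∈ range (D + 1 + 1), p ν j * (j - m ν) ^ 2 = v ν)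
    (hvK : ∀ ν, v ν ≤ K * (p ν D * p ν (D + 1)))
    (hN : Tendsto N atTop atTop) (hNv : Tendsto (fun ν => N ν * v ν) atTop atTop) :
    Tendsto (fun ν => (√(N ν * v ν) : ℂ) *
      ∫ θ in (-π)..π, latticeChar (p ν) (D + 1) (m ν) θ ^ N ν) atTop (nhds (√(2 * π) : ℂ)) := by
  set s : ℕ → ℝ := fun ν => √(N ν * v ν)
  have hs : Tendsto s atTop atTop := Real.tendsto_sqrt_atTop.comp hNv
  have hcont : ∀ ν, Continuous (latticeChar (p ν) (D + 1) (m ν)) := fun ν => by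
    unfold latticeChar; fun_prop
  have hlim : Tendsto (fun ν => ∫ t, (Set.Ioc (-π * s ν) (π * s ν)).indicator
      (fun t => latticeChar (p ν) (D + 1) (m ν) (t / s ν) ^ N ν) t) atTop
      (nhds (∫ t : ℝ, (Real.exp (-(1 / 2) * t ^ 2) : ℂ))) := by
    refine MeasureTheory.tendsto_integral_filter_of_dominated_convergence
      (fun t => Real.exp (-(2 / π ^ 2 / K) * t ^ 2)) ?_ ?_ ?_ ?_
    · refine Eventually.of_forall fun ν => ?_
      have : Continuous fun t : ℝ => latticeChar (p ν) (D + 1) (m ν) (t / s ν) ^ N ν :=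
        ((hcont ν).comp (continuous_id.div_const _)).pow _
      exact (this.measurable.indicator measurableSet_Ioc).aestronglyMeasurable
    · filter_upwards [hs.eventually_gt_atTop 0] with ν hs0
      refine Eventually.of_forall fun t => ?_
      by_cases ht : t ∈ Set.Ioc (-π * s ν) (π * s ν)
      · rw [Set.indicator_of_mem ht, norm_pow]
        have hθ : |t / s ν| ≤ π := by
          rw [abs_div, abs_of_pos hs0, div_le_iff₀ hs0, abs_le]
          exact ⟨by linarith [ht.1], ht.2⟩
        refine (pow_le_pow_left₀ (norm_nonneg _)
          (norm_latticeChar_le (hp ν) (hsum ν) hθ) _).trans ?_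
        rw [← Real.exp_nat_mul, Real.exp_le_exp]
        have hs2 : s ν ^ 2 = N ν * v ν := Real.sq_sqrt (Real.sqrt_pos.1 hs0).le
        have h1 : s ν ^ 2 / K ≤ N ν * (p ν D * p ν (D + 1)) := by
          rw [hs2, div_le_iff₀ hK]
          nlinarith [mul_le_mul_of_nonneg_left (hvK ν) (Nat.cast_nonneg (α := ℝ) (N ν))]
        have h2 := mul_le_mul_of_nonneg_left h1
          (by positivity : 0 ≤ 2 / π ^ 2 * (t / s ν) ^ 2)
        have h3 : 2 / π ^ 2 * (t / s ν) ^ 2 * (s ν ^ 2 / K) = 2 / π ^ 2 / K * t ^ 2 := by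
          field_simp
        nlinarith
      · rw [Set.indicator_of_notMem ht, norm_zero]
        exact (Real.exp_pos _).le
    · exact integrable_exp_neg_mul_sq (by positivity)
    · refine Eventually.of_forall fun t => ?_
      refine (tendsto_latticeChar_pow hp hsum hm hv hN hNv t).congr' ?_
      have hpis : Tendsto (fun ν => π * s ν) atTop atTop := hs.const_mul_atTop Real.pi_pos
      filter_upwards [hpis.eventually_gt_atTop |t|] with ν ht
      rw [Set.indicator_of_mem]
      have := abs_lt.1 ht
      exact ⟨by linarith, by linarith⟩
  have hgauss : ∫ t : ℝ, (Real.exp (-(1 / 2) * t ^ 2) : ℂ) = (√(2 * π) : ℂ) := by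
    rw [integral_complex_ofReal, integral_gaussian,
      show π / (1 / 2) = 2 * π by ring]
  rw [hgauss] at hlim
  refine hlim.congr' ?_
  filter_upwards [hs.eventually_gt_atTop 0] with ν hs0
  rw [MeasureTheory.integral_indicator measurableSet_Ioc,
    ← intervalIntegral.integral_of_le (by nlinarith [Real.pi_pos]),
    intervalIntegral.integral_comp_div
      (fun θ => latticeChar (p ν) (D + 1) (m ν) θ ^ N ν) hs0.ne',
    mul_div_cancel_right₀ _ hs0.ne', mul_div_cancel_right₀ _ hs0.ne', Complex.real_smul]

/-- Point probabilities of the truncated Poisson variable `W(x)`. -/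
noncomputable def probW (C : ℕ) (x : ℝ) (j : ℕ) : ℝ :=
  x ^ j / (Nat.factorial j * gfun C x)

theorem gfun_succ (D : ℕ) (x : ℝ) :
    gfun (D + 1) x = gfun D x + x ^ (D + 1) / (Nat.factorial (D + 1)) :=
  sum_range_succ _ _

theorem gfun_pos (C : ℕ) {x : ℝ} (hx : 0 < x) : 0 < gfun C x :=
  sum_pos (fun j _ => by positivity) ⟨0, by simp⟩

theorem gfun_le_mul_last (D : ℕ) {c x : ℝ} (hc : 0 < c) (hc1 : c ≤ 1) (hx : c ≤ x) :
    gfun D x ≤ (D + 1) * (D.factorial / c ^ D) * (x ^ D / D.factorial) := by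
  have hx0 : 0 < x := hc.trans_le hx
  have hterm : ∀ k ∈ range (D + 1), x ^ k / (Nat.factorial k) ≤ x ^ D / c ^ D := by
    intro k hk
    have hkD : k ≤ D := Nat.lt_succ_iff.1 (mem_range.1 hk)
    have h1 : c ^ D ≤ x ^ (D - k) := calc
      c ^ D ≤ c ^ (D - k) := pow_le_pow_of_le_one hc.le hc1 (Nat.sub_le _ _)
      _ ≤ x ^ (D - k) := pow_le_pow_left₀ hc.le hx _
    calc x ^ k / (Nat.factorial k) ≤ x ^ k :=
          div_le_self (by positivity) (by exact_mod_cast Nat.one_le_iff_ne_zero.2 k.factorial_ne_zero)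
      _ ≤ x ^ D / c ^ D := by
          rw [le_div_iff₀ (by positivity), ← pow_mul_pow_sub x hkD]
          gcongr
  have hsum := sum_le_card_nsmul _ _ _ hterm
  rw [card_range, nsmul_eq_mul] at hsum
  have hD : (D.factorial : ℝ) ≠ 0 := by positivity
  calc gfun D x ≤ _ := hsum
    _ = _ := by push_cast; field_simp

theorem hasDerivAt_gfun (D : ℕ) (x : ℝ) : HasDerivAt (gfun (D + 1)) (gfun D x) x := by
  have h : HasDerivAt (fun y : ℝ => ∑ k ∈ range (D + 1 + 1), y ^ k / (Nat.factorial k))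
      (∑ k ∈ range (D + 1 + 1), (k * x ^ (k - 1)) / (Nat.factorial k)) x :=
    HasDerivAt.fun_sum fun k _ => (hasDerivAt_pow k x).div_const _
  convert! h using 1
  rw [sum_range_succ', gfun]
  simp only [Nat.cast_zero, zero_mul, zero_div, add_zero]
  refine sum_congr rfl fun k _ => ?_
  rw [Nat.factorial_succ, Nat.add_sub_cancel]
  push_cast
  have : (k : ℝ) + 1 ≠ 0 := by positivity
  field_simp

theorem sum_probW (C : ℕ) {x : ℝ} (hx : 0 < x) : ∑ j ∈ range (C + 1), probW C x j = 1 := by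
  simp_rw [probW, ← div_div]
  rw [← sum_div]
  exact div_self (gfun_pos C hx).ne'

theorem meanW_succ (D : ℕ) (x : ℝ) : meanW (D + 1) x = x * gfun D x / gfun (D + 1) x := by
  rw [meanW, sum_range_succ']
  simp only [Nat.cast_zero, zero_mul, add_zero]
  have hg : gfun D x = ∑ k ∈ range (D + 1), x ^ k / (Nat.factorial k) := rfl
  rw [hg, mul_sum, sum_div]
  refine sum_congr rfl fun k _ => ?_
  rw [Nat.factorial_succ, ← mul_div_assoc, ← mul_div_assoc, div_div]
  push_cast
  rw [mul_assoc, mul_div_mul_left _ _ (by positivity), pow_succ']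

theorem sum_probW_mul_sq_sub (C : ℕ) {x : ℝ} (hx : 0 < x) (a : ℝ) :
    ∑ j ∈ range (C + 1), probW C x j * (j - a) ^ 2 = varW C x + (meanW C x - a) ^ 2 := by
  have hm : meanW C x = ∑ j ∈ range (C + 1), j * probW C x j := rfl
  have hv : varW C x = ∑ j ∈ range (C + 1), (j : ℝ) ^ 2 * probW C x j - meanW C x ^ 2 := rfl
  have : ∑ j ∈ range (C + 1), probW C x j * (j - a) ^ 2 =
      ∑ j ∈ range (C + 1), (j : ℝ) ^ 2 * probW C x j -
        2 * a * ∑ j ∈ range (C + 1), j * probW C x j + a ^ 2 * ∑ j ∈ range (C + 1), probW C x j := by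
    rw [mul_sum, mul_sum, ← sum_sub_distrib, ← sum_add_distrib]
    exact sum_congr rfl fun j _ => by ring
  rw [this, sum_probW C hx, ← hm, hv]
  ring

theorem probW_nonneg (C : ℕ) {x : ℝ} (hx : 0 < x) (j : ℕ) : 0 ≤ probW C x j :=
  div_nonneg (by positivity) (mul_nonneg (by positivity) (gfun_pos C hx).le)

theorem probW_mul_probW_le_varW (D : ℕ) {x : ℝ} (hx : 0 < x) :
    probW (D + 1) x D * probW (D + 1) x (D + 1) ≤ varW (D + 1) x := by
  have hv := sum_probW_mul_sq_sub (D + 1) hx (meanW (D + 1) x)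
  have hs := sum_probW (D + 1) hx
  set p := probW (D + 1) x
  have hp : ∀ j, 0 ≤ p j := probW_nonneg _ hx
  set m := meanW (D + 1) x
  rw [sum_range_succ, sum_range_succ] at hv hs
  have h1 : 0 ≤ ∑ j ∈ range D, p j * (j - m) ^ 2 :=
    sum_nonneg fun j _ => mul_nonneg (hp j) (sq_nonneg _)
  have h2 : 0 ≤ ∑ j ∈ range D, p j := sum_nonneg fun j _ => hp j
  have hS : 0 ≤ p D * (D - m) ^ 2 + p (D + 1) * (D + 1 - m) ^ 2 :=
    add_nonneg (mul_nonneg (hp _) (sq_nonneg _)) (mul_nonneg (hp _) (sq_nonneg _))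
  have h3 : p D * p (D + 1) ≤
      (p D + p (D + 1)) * (p D * (D - m) ^ 2 + p (D + 1) * (D + 1 - m) ^ 2) := by
    nlinarith [sq_nonneg ((p D + p (D + 1)) * (D - m) + p (D + 1))]
  push_cast at hv
  nlinarith [mul_le_mul_of_nonneg_right (by linarith : p D + p (D + 1) ≤ 1) hS]

theorem sum_probW_lt (D : ℕ) {x : ℝ} :
    ∑ j ∈ range (D + 1), probW (D + 1) x j = gfun D x / gfun (D + 1) x := by
  simp_rw [probW, ← div_div]
  rw [← sum_div]
  rfl

theorem sub_meanW_le (D : ℕ) {x : ℝ} (hx : 0 < x) :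
    ((D + 1 : ℕ) : ℝ) - meanW (D + 1) x ≤ (D + 1) * (gfun D x / gfun (D + 1) x) := by
  have hm : meanW (D + 1) x = ∑ j ∈ range (D + 1 + 1), j * probW (D + 1) x j := rfl
  have hs := sum_probW (D + 1) hx
  have : ((D + 1 : ℕ) : ℝ) - meanW (D + 1) x =
      ∑ j ∈ range (D + 1 + 1), (((D + 1 : ℕ) : ℝ) - j) * probW (D + 1) x j := by
    simp_rw [sub_mul, sum_sub_distrib, ← mul_sum, hs, hm, mul_one]
  rw [this, sum_range_succ, ← sum_probW_lt, mul_sum, sub_self, zero_mul, add_zero]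
  refine sum_le_sum fun j _ => mul_le_mul_of_nonneg_right ?_ (probW_nonneg _ hx j)
  push_cast
  linarith [j.cast_nonneg (α := ℝ)]

theorem varW_le (D : ℕ) {x : ℝ} (hx : 0 < x) :
    varW (D + 1) x ≤ (D + 1) ^ 2 * (gfun D x / gfun (D + 1) x) := by
  have h := sum_probW_mul_sq_sub (D + 1) hx ((D + 1 : ℕ) : ℝ)
  rw [sum_range_succ, sub_self] at h
  have h2 : ∑ j ∈ range (D + 1), probW (D + 1) x j * ((j : ℝ) - ((D + 1 : ℕ) : ℝ)) ^ 2 ≤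
      (D + 1) ^ 2 * (gfun D x / gfun (D + 1) x) := by
    rw [← sum_probW_lt, mul_sum]
    refine sum_le_sum fun j hj => ?_
    rw [mul_comm]
    refine mul_le_mul_of_nonneg_right ?_ (probW_nonneg _ hx j)
    have hj' : (j : ℝ) ≤ D := by exact_mod_cast Nat.lt_succ_iff.1 (mem_range.1 hj)
    push_cast
    nlinarith [j.cast_nonneg (α := ℝ)]
  nlinarith [sq_nonneg (meanW (D + 1) x - ((D + 1 : ℕ) : ℝ))]

/-- Away from zero, the mass below the maximal value is controlled by the two top weights. -/
theorem exists_gfun_div_le (D : ℕ) {c : ℝ} (hc : 0 < c) : ∃ K, 0 < K ∧ ∀ x, c ≤ x →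
    gfun D x / gfun (D + 1) x ≤ K * (probW (D + 1) x D * probW (D + 1) x (D + 1)) := by
  have hd : 0 < min c 1 := lt_min hc one_pos
  refine ⟨((D + 1) * (D.factorial / min c 1 ^ D)) *
    (((D + 1 : ℕ) + 1) * ((D + 1).factorial / min c 1 ^ (D + 1))), by positivity, fun x hx => ?_⟩
  have hx0 : 0 < x := hc.trans_le hx
  have h1 := gfun_le_mul_last D hd (min_le_right _ _) ((min_le_left _ _).trans hx)
  have h2 := gfun_le_mul_last (D + 1) hd (min_le_right _ _) ((min_le_left _ _).trans hx)
  have hg := gfun_pos (D + 1) hx0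
  have hg' := gfun_pos D hx0
  set A : ℝ := (D + 1) * (D.factorial / min c 1 ^ D)
  set B : ℝ := ((D + 1 : ℕ) + 1) * ((D + 1).factorial / min c 1 ^ (D + 1))
  have e1 : probW (D + 1) x D = x ^ D / D.factorial / gfun (D + 1) x := (div_div _ _ _).symm
  have e2 : probW (D + 1) x (D + 1) = x ^ (D + 1) / (D + 1).factorial / gfun (D + 1) x :=
    (div_div _ _ _).symm
  have h3 : gfun D x / gfun (D + 1) x ≤ A * probW (D + 1) x D := by
    rw [e1, ← mul_div_assoc]
    gcongr
  have h4 : 1 ≤ B * probW (D + 1) x (D + 1) := by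
    rw [e2, ← mul_div_assoc]
    exact (one_le_div hg).2 h2
  calc gfun D x / gfun (D + 1) x = gfun D x / gfun (D + 1) x * 1 := (mul_one _).symm
    _ ≤ (A * probW (D + 1) x D) * (B * probW (D + 1) x (D + 1)) :=
        mul_le_mul h3 h4 zero_le_one ((div_pos hg' hg).le.trans h3)
    _ = _ := by ring

theorem Mcount_eq_mul_sum_probW (n N C : ℕ) {x : ℝ} (hx : 0 < x) :
    (Mcount n N C : ℝ) = n.factorial * gfun C x ^ N / x ^ n *
      ∑ k ∈ (Fintype.piFinset fun _ : Fin N => range (C + 1)).filter (fun k => ∑ j, k j = n),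
        ∏ j, probW C x (k j) := by
  rw [Mcount_eq_sum, mul_sum, mul_sum]
  refine sum_congr rfl fun k hk => ?_
  have hk := (mem_filter.1 hk).2
  have hg := (gfun_pos C hx).ne'
  simp only [probW, prod_div_distrib, prod_mul_distrib, prod_pow_eq_pow_sum, hk, prod_const,
    card_univ, Fintype.card_fin, prod_inv_distrib]
  have : (∏ j, ((k j).factorial : ℝ)) ≠ 0 :=
    prod_ne_zero_iff.2 fun j _ => Nat.cast_ne_zero.2 (Nat.factorial_ne_zero _)
  field_simp

/-- **Theorem (asymptotics of `M_n(N,C)`).** For fixed `C ≥ 1` and `c₁ > 0`, if `N → ∞`,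
`c₁ N < n ≤ CN − 1`, `CN − n → ∞` and `λ₀` is the unique positive solution of
`λ g'(λ)/g(λ) = n/N`, then `M_n(N,C) ∼ n! g(λ₀)^N / (λ₀^n √(2π N Var W(λ₀)))`. -/
theorem statement7 (C : ℕ) (hC : 1 ≤ C) (c₁ : ℝ) (hc₁ : 0 < c₁)
    (n N : ℕ → ℕ) (hNpos : ∀ ν, 0 < N ν)
    (hN : Tendsto N atTop atTop)
    (hlow : ∀ ν, c₁ * N ν < n ν) (hhigh : ∀ ν, n ν ≤ C * N ν - 1)
    (hgap : Tendsto (fun ν => C * N ν - n ν) atTop atTop)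
    (lam0 : ℕ → ℝ) (hlam0pos : ∀ ν, 0 < lam0 ν)
    (hlam0 : ∀ ν, lam0 ν * deriv (gfun C) (lam0 ν) / gfun C (lam0 ν) = (n ν : ℝ) / N ν) :
    Tendsto (fun ν =>
      (Mcount (n ν) (N ν) C : ℝ) /
        ((Nat.factorial (n ν) : ℝ) * gfun C (lam0 ν) ^ (N ν) /
          (lam0 ν ^ (n ν) * Real.sqrt (2 * π * N ν * varW C (lam0 ν)))))
      atTop (nhds 1) := by
  obtain ⟨D, rfl⟩ : ∃ D, C = D + 1 := ⟨C - 1, by omega⟩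
  have hNr : ∀ ν, (0 : ℝ) < N ν := fun ν => by exact_mod_cast hNpos ν
  have hmean : ∀ ν, meanW (D + 1) (lam0 ν) = (n ν : ℝ) / N ν := fun ν => by
    rw [← hlam0 ν, (hasDerivAt_gfun D _).deriv, meanW_succ]
  have hlam : ∀ ν, c₁ ≤ lam0 ν := fun ν => by
    have h1 : c₁ ≤ meanW (D + 1) (lam0 ν) := by
      rw [hmean, le_div_iff₀ (hNr ν)]
      exact (hlow ν).le
    refine h1.trans ?_
    rw [meanW_succ, div_le_iff₀ (gfun_pos _ (hlam0pos ν)), gfun_succ]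
    have h2 := hlam0pos ν
    have h3 : 0 ≤ lam0 ν ^ (D + 1) / ((D + 1).factorial : ℝ) := by positivity
    nlinarith [mul_nonneg h2.le h3]
  obtain ⟨K, hK, hKle⟩ := exists_gfun_div_le D hc₁
  have hvK : ∀ ν, varW (D + 1) (lam0 ν) ≤ ((D + 1) ^ 2 * K) *
      (probW (D + 1) (lam0 ν) D * probW (D + 1) (lam0 ν) (D + 1)) := fun ν => by
    refine (varW_le D (hlam0pos ν)).trans ?_
    rw [mul_assoc]
    exact mul_le_mul_of_nonneg_left (hKle _ (hlam ν)) (by positivity)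
  have hNv : Tendsto (fun ν => N ν * varW (D + 1) (lam0 ν)) atTop atTop := by
    have hgapr : Tendsto (fun ν => (((D + 1) * N ν - n ν : ℕ) : ℝ) / ((D + 1) * K)) atTop atTop :=
      (tendsto_natCast_atTop_atTop.comp hgap).atTop_div_const (by positivity)
    refine tendsto_atTop_mono (fun ν => ?_) hgapr
    have hle : n ν ≤ (D + 1) * N ν := (hhigh ν).trans (Nat.sub_le _ _)
    rw [div_le_iff₀ (by positivity), Nat.cast_sub hle]
    have h1 := sub_meanW_le D (hlam0pos ν)
    have h2 := mul_le_mul_of_nonneg_left (hKle _ (hlam ν)) (by positivity : (0 : ℝ) ≤ D + 1)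
    have h3 := mul_le_mul_of_nonneg_left (probW_mul_probW_le_varW D (hlam0pos ν))
      (by positivity : 0 ≤ (D + 1) * K)
    have h4 : ((D + 1 : ℕ) : ℝ) - n ν / N ν ≤ (D + 1) * K * varW (D + 1) (lam0 ν) := by
      rw [← hmean]
      linarith
    have h5 := mul_le_mul_of_nonneg_left h4 (hNr ν).le
    rw [mul_sub, mul_div_cancel₀ _ (hNr ν).ne'] at h5
    push_cast at h5 ⊢
    linarith
  have hLLT := tendsto_sqrt_mul_integral_latticeChar_pow
    (p := fun ν => probW (D + 1) (lam0 ν)) (m := fun ν => meanW (D + 1) (lam0 ν)) (by positivity)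
    (fun ν => probW_nonneg _ (hlam0pos ν)) (fun ν => sum_probW _ (hlam0pos ν)) (fun ν => rfl)
    (fun ν => (sum_probW_mul_sq_sub _ (hlam0pos ν) _).trans (by rw [sub_self]; ring)) hvK hN hNv
  let P : ℕ → ℝ := fun ν =>
    ∑ k ∈ (Fintype.piFinset fun _ : Fin (N ν) => range (D + 1 + 1)).filter
      (fun k => ∑ j, k j = n ν), ∏ j, probW (D + 1) (lam0 ν) (k j)
  have hint : ∀ ν, ∫ θ in (-π)..π, latticeChar (probW (D + 1) (lam0 ν)) (D + 1)
      (meanW (D + 1) (lam0 ν)) θ ^ N ν = 2 * π * (P ν : ℂ) := fun ν =>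
    integral_charFun_pow _ _ _ _ _ (by rw [hmean, mul_div_cancel₀ _ (hNr ν).ne'])
  have hreal : Tendsto (fun ν => √(N ν * varW (D + 1) (lam0 ν)) * (2 * π * P ν)) atTop
      (nhds √(2 * π)) := by
    have h := (Complex.continuous_re.tendsto _).comp hLLT
    simp only [Function.comp_def, Complex.ofReal_re] at h
    refine h.congr fun ν => ?_
    rw [hint]
    norm_cast
  have h2π : √(2 * π) ≠ 0 := (Real.sqrt_pos.2 (by positivity)).ne'
  have hdiv := hreal.div_const √(2 * π)
  rw [div_self h2π] at hdiv
  refine hdiv.congr fun ν => ?_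
  rw [Mcount_eq_mul_sum_probW _ _ _ (hlam0pos ν)]
  change _ = _ * P ν / _
  have hg := (gfun_pos (D + 1) (hlam0pos ν)).ne'
  have hl := (hlam0pos ν).ne'
  have hsq : √(2 * π * N ν * varW (D + 1) (lam0 ν)) =
      √(2 * π) * √(N ν * varW (D + 1) (lam0 ν)) := by
    rw [mul_assoc (2 * π), Real.sqrt_mul (by positivity)]
  rw [hsq]
  have hs2 : √(2 * π) * √(2 * π) = 2 * π := Real.mul_self_sqrt (by positivity)
  rw [show 2 * π * P ν = √(2 * π) * √(2 * π) * P ν by rw [hs2]]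
  have hfac : ((n ν).factorial : ℝ) ≠ 0 := by positivity
  rw [div_div_eq_mul_div]
  field_simp
end

section
/- Let k be a positive integer and let a, b be real numbers with a ≥ b > k. Then k·log(a/b) ≤ log( [a]_k / [b]_k ) ≤ k·log( (a−k)/(b−k) ) ≤ ( k·log(a/b) ) / (1 − k/b). -/
/-- Subtracting a larger amount from both entries increases the ratio `a / b ≥ 1`. -/
lemma sub_div_sub_le_sub_div_sub {a b c d : ℝ} (hab : b ≤ a) (hcd : c ≤ d) (hdb : d < b) :
    (a - c) / (b - c) ≤ (a - d) / (b - d) := by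
  rw [div_le_div_iff₀ (by linarith) (by linarith)]
  nlinarith [mul_nonneg (sub_nonneg.2 hab) (sub_nonneg.2 hcd)]

lemma log_sub_div_sub_le_log_sub_div_sub {a b c d : ℝ} (hab : b ≤ a) (hcd : c ≤ d)
    (hdb : d < b) : Real.log ((a - c) / (b - c)) ≤ Real.log ((a - d) / (b - d)) :=
  Real.log_le_log (div_pos (by linarith) (by linarith)) (sub_div_sub_le_sub_div_sub hab hcd hdb)

lemma log_descPochhammer_div (k : ℕ) {a b : ℝ} (hab : b ≤ a) (hbk : (k : ℝ) < b) :
    Real.log ((descPochhammer ℝ k).eval a / (descPochhammer ℝ k).eval b) =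
      ∑ i ∈ Finset.range k, Real.log ((a - i) / (b - i)) := by
  rw [descPochhammer_eval_eq_prod_range, descPochhammer_eval_eq_prod_range,
    ← Finset.prod_div_distrib, Real.log_prod]
  intro i hi
  have hik : (i : ℝ) < k := by exact_mod_cast Finset.mem_range.1 hi
  exact (div_pos (by linarith) (by linarith)).ne'

/-- A consequence of Bernoulli's inequality for exponents in `[0, 1]`. -/
lemma log_sub_div_sub_le_log_div_div {a b x : ℝ} (hab : b ≤ a) (hx : 0 ≤ x) (hxb : x < b) :
    Real.log ((a - x) / (b - x)) ≤ Real.log (a / b) / (1 - x / b) := by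
  have hb : 0 < b := by linarith
  have hbx : 0 < b - x := by linarith
  have ht : 0 < 1 - x / b := by rw [sub_pos, div_lt_one hb]; exact hxb
  have hratio : 0 < (a - x) / (b - x) := div_pos (by linarith) hbx
  rw [le_div_iff₀ ht, mul_comm, ← Real.log_rpow hratio]
  refine Real.log_le_log (Real.rpow_pos_of_pos hratio _) ?_
  have hs : 0 ≤ (a - b) / (b - x) := div_nonneg (by linarith) hbx.le
  have key := rpow_one_add_le_one_add_mul_self (by linarith) ht.le
    (sub_le_self 1 (div_nonneg hx hb.le)) (s := (a - b) / (b - x))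
  convert key using 1
  · congr 1
    field_simp
    ring
  · field_simp
    ring


/-- **Lemma.** For a positive integer `k` and reals `a ≥ b > k`,
`k log(a/b) ≤ log([a]_k/[b]_k) ≤ k log((a−k)/(b−k)) ≤ k log(a/b)/(1 − k/b)`,
where `[y]_k = y(y−1)···(y−k+1)` is the falling factorial. -/
theorem statement8 (k : ℕ) (hk : 0 < k) (a b : ℝ) (hab : b ≤ a) (hbk : (k : ℝ) < b) :
    (k : ℝ) * Real.log (a / b) ≤
        Real.log ((descPochhammer ℝ k).eval a / (descPochhammer ℝ k).eval b) ∧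
    Real.log ((descPochhammer ℝ k).eval a / (descPochhammer ℝ k).eval b) ≤
        (k : ℝ) * Real.log ((a - k) / (b - k)) ∧
    (k : ℝ) * Real.log ((a - k) / (b - k)) ≤
        (k : ℝ) * Real.log (a / b) / (1 - (k : ℝ) / b) := by
  have hk0 : (0 : ℝ) ≤ k := k.cast_nonneg
  rw [log_descPochhammer_div k hab hbk]
  refine ⟨?_, ?_, ?_⟩
  · have h := Finset.card_nsmul_le_sum (Finset.range k)
      (fun i : ℕ ↦ Real.log ((a - i) / (b - i))) (Real.log (a / b)) fun i hi ↦ by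
        have hik : (i : ℝ) < k := by exact_mod_cast Finset.mem_range.1 hi
        simpa using log_sub_div_sub_le_log_sub_div_sub hab i.cast_nonneg (hik.trans hbk)
    simpa using h
  · have h := Finset.sum_le_card_nsmul (Finset.range k)
      (fun i : ℕ ↦ Real.log ((a - i) / (b - i))) (Real.log ((a - k) / (b - k))) fun i hi ↦ by
        have hik : (i : ℝ) < k := by exact_mod_cast Finset.mem_range.1 hi
        exact log_sub_div_sub_le_log_sub_div_sub hab hik.le hbk
    simpa using h
  · rw [mul_div_assoc]
    exact mul_le_mul_of_nonneg_left (log_sub_div_sub_le_log_div_div hab hk0 hbk) hk0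
end

section
/- Let (μ_n) be a sequence of positive reals with μ_n → ∞ and let (k_n) be nonnegative integers with k_n = o(μ_n^{2/3}). Then [μ_n]_{k_n} / ( μ_n^{k_n} · exp( − k_n^2/(2 μ_n) ) ) → 1 as n → ∞. -/
open Filter

theorem exp_neg_sub_sq_le_one_sub {x : ℝ} (h0 : 0 ≤ x) (h1 : x ≤ 1 / 2) :
    Real.exp (-(x + x ^ 2)) ≤ 1 - x := by
  have hq := Real.quadratic_le_exp_of_nonneg (x := x + x ^ 2) (by positivity)
  rw [Real.exp_neg, inv_le_comm₀ (Real.exp_pos _) (by linarith)]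
  refine le_trans ?_ hq
  rw [inv_le_iff_one_le_mul₀ (by linarith)]
  have h2 : x ^ 2 ≤ 1 / 4 := by nlinarith
  have h3 : x ^ 3 ≤ 1 / 8 := by nlinarith
  have h4 : 0 ≤ x ^ 2 * (1 - x - x ^ 2 - x ^ 3) := mul_nonneg (sq_nonneg x) (by linarith)
  nlinarith

/-- Two-sided exponential bounds for the falling factorial `[m]_k` when `2 * k ≤ m`. -/
theorem descPochhammer_eval_bounds {m : ℝ} (hm : 0 < m) (k : ℕ) (hk : 2 * (k : ℝ) ≤ m) :
    m ^ k * Real.exp (-(k : ℝ) ^ 2 / (2 * m) - (k : ℝ) ^ 3 / m ^ 2) ≤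
        (descPochhammer ℝ k).eval m ∧
      (descPochhammer ℝ k).eval m ≤
        m ^ k * Real.exp (-(k : ℝ) ^ 2 / (2 * m) + (k : ℝ) / (2 * m)) := by
  induction k with
  | zero => simp
  | succ k ih =>
    push_cast at hk ⊢
    obtain ⟨hl, hu⟩ := ih (by linarith)
    have hk0 : (0 : ℝ) ≤ k := k.cast_nonneg
    have hle : m * Real.exp (-((k : ℝ) / m + ((k : ℝ) / m) ^ 2)) ≤ m - k := by
      have := exp_neg_sub_sq_le_one_sub (x := (k : ℝ) / m) (by positivity)
        (by rw [div_le_iff₀ hm]; linarith)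
      calc _ ≤ m * (1 - k / m) := by gcongr
        _ = m - k := by field_simp
    have hge : m - k ≤ m * Real.exp (-((k : ℝ) / m)) := by
      have := Real.one_sub_le_exp_neg ((k : ℝ) / m)
      calc m - k = m * (1 - k / m) := by field_simp
        _ ≤ _ := by gcongr
    have hmk : 0 ≤ m - k := by linarith
    rw [descPochhammer_succ_eval]
    constructor
    · refine le_trans ?_ (mul_le_mul hl hle (by positivity) (le_trans (by positivity) hl))
      rw [mul_mul_mul_comm, ← pow_succ, ← Real.exp_add]
      gcongr
      have : -(k : ℝ) ^ 2 / (2 * m) - (k : ℝ) ^ 3 / m ^ 2 + -((k : ℝ) / m + ((k : ℝ) / m) ^ 2)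
          - (-((k : ℝ) + 1) ^ 2 / (2 * m) - ((k : ℝ) + 1) ^ 3 / m ^ 2)
          = 1 / (2 * m) + (2 * (k : ℝ) ^ 2 + 3 * k + 1) / m ^ 2 := by
        field_simp
        ring
      have : 0 ≤ 1 / (2 * m) + (2 * (k : ℝ) ^ 2 + 3 * k + 1) / m ^ 2 := by positivity
      linarith
    · refine le_trans (mul_le_mul hu hge hmk (by positivity)) (le_of_eq ?_)
      rw [mul_mul_mul_comm, ← pow_succ, ← Real.exp_add]
      congr 2
      field_simp
      ring

/-- **Lemma.** If `μ_n → ∞` (positive reals) and `k_n` are nonnegative integers with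
`k_n = o(μ_n^{2/3})`, then `[μ_n]_{k_n} / (μ_n^{k_n} exp(−k_n²/(2μ_n))) → 1`,
where `[y]_k` denotes the falling factorial. -/
theorem statement9 (μ : ℕ → ℝ) (hμpos : ∀ n, 0 < μ n) (hμ : Tendsto μ atTop atTop)
    (k : ℕ → ℕ) (hk : Tendsto (fun n => (k n : ℝ) / μ n ^ ((2:ℝ)/3)) atTop (nhds 0)) :
    Tendsto (fun n =>
      (descPochhammer ℝ (k n)).eval (μ n) /
        (μ n ^ (k n) * Real.exp (-(k n : ℝ) ^ 2 / (2 * μ n))))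
      atTop (nhds 1) := by
  have hcube : Tendsto (fun n => (k n : ℝ) ^ 3 / μ n ^ 2) atTop (nhds 0) := by
    have h := hk.pow 3
    rw [zero_pow three_ne_zero] at h
    refine h.congr fun n => ?_
    rw [div_pow, ← Real.rpow_mul_natCast (hμpos n).le]
    norm_num
  have hlin : Tendsto (fun n => (k n : ℝ) / μ n) atTop (nhds 0) := by
    have h := hk.mul ((tendsto_rpow_neg_atTop (y := 1 / 3) (by norm_num)).comp hμ)
    rw [zero_mul] at h
    refine h.congr fun n => ?_
    rw [Function.comp_apply, Real.rpow_neg (hμpos n).le, ← div_eq_mul_inv, div_div,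
      ← Real.rpow_add (hμpos n)]
    norm_num
  have hlow : Tendsto (fun n => Real.exp (-((k n : ℝ) ^ 3 / μ n ^ 2))) atTop (nhds 1) := by
    simpa using hcube.neg.rexp
  have hupp : Tendsto (fun n => Real.exp ((k n : ℝ) / μ n / 2)) atTop (nhds 1) := by
    simpa using (hlin.div_const 2).rexp
  have hsmall : ∀ᶠ n in atTop, 2 * (k n : ℝ) ≤ μ n := by
    filter_upwards [hlin.eventually_le_const (show (0 : ℝ) < 1 / 2 by norm_num)] with n hn
    rw [div_le_iff₀ (hμpos n)] at hn
    linarith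
  refine tendsto_of_tendsto_of_tendsto_of_le_of_le' hlow hupp ?_ ?_
  · filter_upwards [hsmall] with n hn
    have hm := hμpos n
    rw [le_div_iff₀ (by positivity), mul_left_comm, ← Real.exp_add, neg_add_eq_sub]
    exact (descPochhammer_eval_bounds hm (k n) hn).1
  · filter_upwards [hsmall] with n hn
    have hm := hμpos n
    rw [div_le_iff₀ (by positivity), mul_left_comm, ← Real.exp_add, add_comm, div_div,
      mul_comm (μ n) 2]
    exact (descPochhammer_eval_bounds hm (k n) hn).2
end

section
/- Fix an integer C ≥ 2. As λ → ∞, the truncated Poisson random variable W(λ) satisfies E[W(λ)] = C·(1 − 1/λ + (2−C)/λ²) + O(λ^{-3}) and Var(W(λ)) = (C/λ)·(1 + 2(C−2)/λ) + O(λ^{-3}). -/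
open Finset
open scoped BigOperators

/-- The unnormalised `k`-th moment of `C - W`, as a polynomial in `t = 1 / λ`. -/
noncomputable def deficitMoment (C k : ℕ) (t : ℝ) : ℝ :=
  ∑ i ∈ Finset.range (C + 1), (i : ℝ) ^ k * (C.descFactorial i : ℝ) * t ^ i

lemma sum_deficit_pow_mul (C k : ℕ) {x : ℝ} (hx : 0 < x) :
    ∑ j ∈ Finset.range (C + 1), ((C : ℝ) - j) ^ k * (x ^ j / (Nat.factorial j))
      = x ^ C / (Nat.factorial C) * deficitMoment C k (1 / x) := by
  rw [← Finset.sum_flip, deficitMoment, Finset.mul_sum]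
  refine Finset.sum_congr rfl fun i hi => ?_
  have hi : i ≤ C := Nat.lt_succ_iff.mp (Finset.mem_range.mp hi)
  have hf : ((C - i).factorial : ℝ) * C.descFactorial i = C.factorial := by
    exact_mod_cast Nat.factorial_mul_descFactorial hi
  have hp : x ^ C = x ^ (C - i) * x ^ i := by rw [← pow_add, Nat.sub_add_cancel hi]
  have h1 : ((C - i).factorial : ℝ) ≠ 0 := by positivity
  have h2 : (C.descFactorial i : ℝ) ≠ 0 := by
    exact_mod_cast (Nat.descFactorial_pos.mpr hi).ne'
  rw [Nat.cast_sub hi, hp, ← hf, one_div, inv_pow]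
  field_simp
  ring

lemma gfun_eq (C : ℕ) {x : ℝ} (hx : 0 < x) :
    gfun C x = x ^ C / (Nat.factorial C) * deficitMoment C 0 (1 / x) := by
  simpa [gfun] using sum_deficit_pow_mul C 0 hx

lemma deficitMoment_zero_pos (C : ℕ) {t : ℝ} (ht : 0 ≤ t) : 0 < deficitMoment C 0 t := by
  rw [deficitMoment, Finset.sum_range_succ']
  simp only [pow_zero, Nat.descFactorial_zero, Nat.cast_one, mul_one, one_mul]
  positivity

lemma sum_deficit_pow_mul_prob (C k : ℕ) {x : ℝ} (hx : 0 < x) :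
    ∑ j ∈ Finset.range (C + 1), ((C : ℝ) - j) ^ k * (x ^ j / (Nat.factorial j * gfun C x))
      = deficitMoment C k (1 / x) / deficitMoment C 0 (1 / x) := by
  have h0 := deficitMoment_zero_pos C (t := 1 / x) (by positivity)
  have h : ∑ j ∈ Finset.range (C + 1),
      ((C : ℝ) - j) ^ k * (x ^ j / (Nat.factorial j * gfun C x))
      = (∑ j ∈ Finset.range (C + 1), ((C : ℝ) - j) ^ k * (x ^ j / (Nat.factorial j)))
        / gfun C x := by
    rw [Finset.sum_div]
    exact Finset.sum_congr rfl fun j _ => by rw [← div_div, mul_div_assoc]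
  rw [h, sum_deficit_pow_mul C k hx, gfun_eq C hx]
  exact mul_div_mul_left _ _ (by positivity)

lemma meanW_eq (C : ℕ) {x : ℝ} (hx : 0 < x) :
    meanW C x = C - deficitMoment C 1 (1 / x) / deficitMoment C 0 (1 / x) := by
  have h0 := deficitMoment_zero_pos C (t := 1 / x) (by positivity)
  have e0 := sum_deficit_pow_mul_prob C 0 hx
  rw [div_self h0.ne'] at e0
  have h1 : meanW C x
      = (C : ℝ) * 1 - deficitMoment C 1 (1 / x) / deficitMoment C 0 (1 / x) := by
    rw [← sum_deficit_pow_mul_prob C 1 hx, ← e0, meanW, Finset.mul_sum,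
      ← Finset.sum_sub_distrib]
    exact Finset.sum_congr rfl fun j _ => by ring
  rw [h1, mul_one]

lemma varW_eq (C : ℕ) {x : ℝ} (hx : 0 < x) :
    varW C x = deficitMoment C 2 (1 / x) / deficitMoment C 0 (1 / x)
      - (deficitMoment C 1 (1 / x) / deficitMoment C 0 (1 / x)) ^ 2 := by
  have h0 := deficitMoment_zero_pos C (t := 1 / x) (by positivity)
  have e0 := sum_deficit_pow_mul_prob C 0 hx
  rw [div_self h0.ne'] at e0
  have h2 : ∑ j ∈ Finset.range (C + 1), (j : ℝ) ^ 2 * (x ^ j / (Nat.factorial j * gfun C x))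
      = (C : ℝ) ^ 2 * 1
        - 2 * C * (deficitMoment C 1 (1 / x) / deficitMoment C 0 (1 / x))
        + deficitMoment C 2 (1 / x) / deficitMoment C 0 (1 / x) := by
    rw [← sum_deficit_pow_mul_prob C 1 hx, ← sum_deficit_pow_mul_prob C 2 hx, ← e0,
      Finset.mul_sum, Finset.mul_sum, ← Finset.sum_sub_distrib, ← Finset.sum_add_distrib]
    exact Finset.sum_congr rfl fun j _ => by ring
  rw [varW, h2, meanW_eq C hx]
  ring

lemma exists_deficitMoment_eq {C : ℕ} (hC : 2 ≤ C) (k : ℕ) :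
    ∃ r : ℝ → ℝ, Continuous r ∧ ∀ t, deficitMoment C k t
      = 0 ^ k + C * t + 2 ^ k * (C * (C - 1)) * t ^ 2 + t ^ 3 * r t := by
  obtain ⟨n, rfl⟩ := Nat.exists_eq_add_of_le' hC
  refine ⟨fun t => ∑ i ∈ Finset.range n,
    ((i + 3 : ℕ) : ℝ) ^ k * ((n + 2).descFactorial (i + 3) : ℝ) * t ^ i, by fun_prop,
    fun t => ?_⟩
  rw [deficitMoment, Finset.sum_range_succ', Finset.sum_range_succ', Finset.sum_range_succ',
    Finset.mul_sum]
  have hs : ∑ i ∈ Finset.range n, ((i + 1 + 1 + 1 : ℕ) : ℝ) ^ k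
        * ((n + 2).descFactorial (i + 1 + 1 + 1) : ℝ) * t ^ (i + 1 + 1 + 1)
      = ∑ i ∈ Finset.range n, t ^ 3 * (((i + 3 : ℕ) : ℝ) ^ k
        * ((n + 2).descFactorial (i + 3) : ℝ) * t ^ i) :=
    Finset.sum_congr rfl fun i _ => by ring
  rw [hs]
  have hd : (n + 2).descFactorial 2 = (n + 2) * (n + 1) := by
    simp [Nat.descFactorial_succ, mul_comm]
  simp only [zero_add, Nat.reduceAdd, hd, Nat.descFactorial_zero, Nat.descFactorial_one]
  push_cast
  ring

/-- Second-order expansion at `0` of a quotient whose denominator has constant term `1`. -/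
lemma exists_div_eq_quadratic_add {N D r s : ℝ → ℝ} {a b c d : ℝ} (hr : Continuous r)
    (hs : Continuous s) (hN : ∀ t, N t = a * t + b * t ^ 2 + t ^ 3 * r t)
    (hD : ∀ t, D t = 1 + c * t + d * t ^ 2 + t ^ 3 * s t)
    {S : Set ℝ} (hD0 : ∀ t ∈ S, D t ≠ 0) :
    ∃ q : ℝ → ℝ, ContinuousOn q S ∧
      ∀ t ∈ S, N t / D t = a * t + (b - a * c) * t ^ 2 + t ^ 3 * q t := by
  have hDc : Continuous D := by
    rw [funext hD]
    fun_prop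
  refine ⟨fun t => (r t - (b - a * c) * c - a * d - t * (b - a * c) * d
    - (a * t + (b - a * c) * t ^ 2) * s t) / D t,
    ContinuousOn.div (by fun_prop) hDc.continuousOn hD0, fun t ht => ?_⟩
  have h := hD0 t ht
  field_simp
  rw [hN, hD]
  ring

/-- **Lemma (expansions of the truncated Poisson mean and variance).** For fixed `C ≥ 2`,
as `λ → ∞`, `E[W(λ)] = C(1 − 1/λ + (2−C)/λ²) + O(λ^{-3})` and
`Var(W(λ)) = (C/λ)(1 + 2(C−2)/λ) + O(λ^{-3})`. -/
theorem statement12 (C : ℕ) (hC : 2 ≤ C) :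
    ∃ c lam₁ : ℝ, ∀ x : ℝ, lam₁ ≤ x →
      |meanW C x - (C : ℝ) * (1 - 1 / x + ((2 : ℝ) - C) / x ^ 2)| ≤ c / x ^ 3 ∧
      |varW C x - ((C : ℝ) / x) * (1 + 2 * ((C : ℝ) - 2) / x)| ≤ c / x ^ 3 := by
  obtain ⟨r₀, hr₀, h₀⟩ := exists_deficitMoment_eq hC 0
  obtain ⟨r₁, hr₁, h₁⟩ := exists_deficitMoment_eq hC 1
  obtain ⟨r₂, hr₂, h₂⟩ := exists_deficitMoment_eq hC 2
  have hD0 : ∀ t ∈ Set.Icc (0 : ℝ) 1, deficitMoment C 0 t ≠ 0 := fun t ht =>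
    (deficitMoment_zero_pos C ht.1).ne'
  obtain ⟨q₁, hq₁, e₁⟩ := exists_div_eq_quadratic_add (N := deficitMoment C 1) (a := C)
    (b := 2 * (C * (C - 1))) (c := C) (d := C * (C - 1)) hr₁ hr₀ (fun t => by rw [h₁]; ring)
    (fun t => by rw [h₀]; ring) hD0
  obtain ⟨q₂, hq₂, e₂⟩ := exists_div_eq_quadratic_add (N := deficitMoment C 2) (a := C)
    (b := 4 * (C * (C - 1))) (c := C) (d := C * (C - 1)) hr₂ hr₀ (fun t => by rw [h₂]; ring)
    (fun t => by rw [h₀]; ring) hD0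
  obtain ⟨M₁, hM₁⟩ := isCompact_Icc.exists_bound_of_continuousOn hq₁
  obtain ⟨M₂, hM₂⟩ := isCompact_Icc.exists_bound_of_continuousOn
    (f := fun t => q₂ t - 2 * C * (C * (C - 2) + t * q₁ t)
      - t * (C * (C - 2) + t * q₁ t) ^ 2) (s := Set.Icc (0 : ℝ) 1) (by fun_prop)
  refine ⟨max M₁ M₂, 1, fun x hx => ?_⟩
  have hx0 : 0 < x := by linarith
  have ht : 1 / x ∈ Set.Icc (0 : ℝ) 1 := ⟨by positivity, by rw [div_le_one hx0]; exact hx⟩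
  have bound : ∀ {y : ℝ}, |y| ≤ max M₁ M₂ → |(1 / x) ^ 3 * y| ≤ max M₁ M₂ / x ^ 3 := by
    intro y hy
    have h3 : (0 : ℝ) ≤ (1 / x) ^ 3 := by positivity
    rw [abs_mul, abs_of_nonneg h3]
    calc (1 / x) ^ 3 * |y| ≤ (1 / x) ^ 3 * max M₁ M₂ := by gcongr
      _ = max M₁ M₂ / x ^ 3 := by ring
  constructor
  · rw [meanW_eq C hx0, e₁ _ ht]
    convert bound (y := -q₁ (1 / x)) ?_ using 2
    · ring
    · rw [abs_neg]
      exact (hM₁ _ ht).trans (le_max_left _ _)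
  · rw [varW_eq C hx0, e₁ _ ht, e₂ _ ht]
    convert bound ((hM₂ _ ht).trans (le_max_right _ _)) using 2
    ring
end

section
/- Fix an integer C ≥ 1. Let n = n(ν) and N = N(ν) be sequences of positive integers with N → ∞, n ≤ CN − 1 and n/N → C, and let λ_0 = λ_0(n/N) be the unique positive solution of λ g′(λ)/g(λ) = n/N. Then λ_0 → ∞ and λ_0 · (1 − n/(CN)) → 1, i.e. 1/λ_0 ∼ 1 − n/(CN). -/
open Filter Finset
open scoped BigOperators

/-- The Euler derivative of `gfun C` multiplies the `k`-th term by `k`. -/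
theorem mul_deriv_gfun (C : ℕ) (x : ℝ) :
    x * deriv (gfun C) x = ∑ k ∈ Finset.range (C + 1), (k : ℝ) * (x ^ k / (Nat.factorial k)) := by
  have h : HasDerivAt (gfun C)
      (∑ k ∈ Finset.range (C + 1), ((k : ℝ) * x ^ (k - 1)) / (Nat.factorial k)) x := by
    unfold gfun
    exact HasDerivAt.fun_sum fun k _ => (hasDerivAt_pow k x).div_const _
  rw [h.deriv, Finset.mul_sum]
  refine Finset.sum_congr rfl fun k _ => ?_
  rcases k with _ | k
  · simp
  · rw [Nat.add_sub_cancel, pow_succ]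
    ring

theorem one_le_gfun (C : ℕ) {x : ℝ} (hx : 0 ≤ x) : 1 ≤ gfun C x := by
  unfold gfun
  rw [Finset.sum_range_succ']
  have : 0 ≤ ∑ k ∈ Finset.range C, x ^ (k + 1) / ((k + 1).factorial : ℝ) :=
    Finset.sum_nonneg fun k _ => by positivity
  simpa using this

theorem gfun_le_gfun (C : ℕ) {x y : ℝ} (hx : 0 ≤ x) (hxy : x ≤ y) : gfun C x ≤ gfun C y := by
  unfold gfun
  gcongr

/-- The numerator of `C - x g'(x) / g(x)`. -/
noncomputable def gfunDefect (C : ℕ) (x : ℝ) : ℝ :=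
  ∑ k ∈ Finset.range C, ((C : ℝ) - k) * (x ^ k / (Nat.factorial k))

theorem mul_gfun_sub_mul_deriv (C : ℕ) (x : ℝ) :
    C * gfun C x - x * deriv (gfun C) x = gfunDefect C x := by
  rw [mul_deriv_gfun, gfun, gfunDefect, Finset.mul_sum, ← Finset.sum_sub_distrib,
    Finset.sum_range_succ]
  simp [sub_mul]

theorem sub_mul_deriv_div_gfun (C : ℕ) {x : ℝ} (hx : 0 ≤ x) :
    C - x * deriv (gfun C) x / gfun C x = gfunDefect C x / gfun C x := by
  have := one_le_gfun C hx
  rw [← mul_gfun_sub_mul_deriv]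
  field_simp

theorem le_gfunDefect {C : ℕ} (hC : 1 ≤ C) {x : ℝ} (hx : 0 ≤ x) : (C : ℝ) ≤ gfunDefect C x := by
  have h := Finset.single_le_sum (s := Finset.range C)
    (f := fun k : ℕ => ((C : ℝ) - k) * (x ^ k / (Nat.factorial k)))
    (fun k hk => mul_nonneg (sub_nonneg.2 (by exact_mod_cast (Finset.mem_range.1 hk).le))
      (by positivity)) (Finset.mem_range.2 hC)
  simpa [gfunDefect] using h

theorem tendsto_pow_div_pow_atTop_ite {k C : ℕ} (h : k ≤ C) :
    Tendsto (fun x : ℝ => x ^ k / x ^ C) atTop (nhds (if k = C then 1 else 0)) := by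
  split_ifs with hk
  · subst hk
    refine tendsto_const_nhds.congr' ?_
    filter_upwards [eventually_gt_atTop 0] with x hx
    rw [div_self (by positivity)]
  · exact tendsto_pow_div_pow_atTop_zero (lt_of_le_of_ne h hk)

theorem tendsto_gfun_div_pow (C : ℕ) :
    Tendsto (fun x => gfun C x / x ^ C) atTop (nhds (1 / (Nat.factorial C : ℝ))) := by
  have h := tendsto_finsetSum (Finset.range (C + 1)) fun k hk =>
    (tendsto_pow_div_pow_atTop_ite (Finset.mem_range_succ_iff.1 hk)).div_const
      (Nat.factorial k : ℝ)
  convert h using 1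
  · funext x
    rw [gfun, Finset.sum_div]
    exact Finset.sum_congr rfl fun k _ => by ring
  · simp [ite_div]

theorem tendsto_mul_gfunDefect_div_pow {C : ℕ} (hC : 1 ≤ C) :
    Tendsto (fun x => x * gfunDefect C x / x ^ C) atTop (nhds (C / (Nat.factorial C : ℝ))) := by
  have h := tendsto_finsetSum (Finset.range C) fun k hk =>
    (tendsto_pow_div_pow_atTop_ite (Nat.succ_le_of_lt (Finset.mem_range.1 hk))).mul_const
      (((C : ℝ) - k) / (Nat.factorial k : ℝ))
  convert h using 1
  · funext x
    rw [gfunDefect, Finset.mul_sum, Finset.sum_div]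
    exact Finset.sum_congr rfl fun k _ => by rw [Nat.succ_eq_add_one, pow_succ]; ring
  · obtain ⟨m, rfl⟩ := Nat.exists_eq_add_of_le' hC
    simp [Nat.factorial_succ, ite_mul]
    field_simp

theorem tendsto_mul_gfunDefect_div_gfun {C : ℕ} (hC : 1 ≤ C) :
    Tendsto (fun x => x * gfunDefect C x / gfun C x) atTop (nhds C) := by
  have h := (tendsto_mul_gfunDefect_div_pow hC).div (tendsto_gfun_div_pow C) (by positivity)
  have hval : (C / (Nat.factorial C : ℝ)) / (1 / (Nat.factorial C : ℝ)) = C := by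
    field_simp
  rw [hval] at h
  refine h.congr' ?_
  filter_upwards [eventually_gt_atTop 0] with x hx
  exact div_div_div_cancel_right₀ (by positivity) _ _

/-- **Lemma.** Fix `C ≥ 1`. If `N → ∞`, `n ≤ CN − 1` and `n/N → C`, and `λ₀` is the unique
positive solution of `λ g'(λ)/g(λ) = n/N`, then `λ₀ → ∞` and `λ₀ (1 − n/(CN)) → 1`,
i.e. `1/λ₀ ∼ 1 − n/(CN)`. -/
theorem statement14 (C : ℕ) (hC : 1 ≤ C)
    (n N : ℕ → ℕ) (hNpos : ∀ ν, 0 < N ν)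
    (hN : Tendsto N atTop atTop)
    (hhigh : ∀ ν, n ν ≤ C * N ν - 1)
    (hratio : Tendsto (fun ν => (n ν : ℝ) / N ν) atTop (nhds (C : ℝ)))
    (lam0 : ℕ → ℝ) (hlam0pos : ∀ ν, 0 < lam0 ν)
    (hlam0 : ∀ ν, lam0 ν * deriv (gfun C) (lam0 ν) / gfun C (lam0 ν) = (n ν : ℝ) / N ν) :
    Tendsto lam0 atTop atTop ∧
    Tendsto (fun ν => lam0 ν * (1 - (n ν : ℝ) / (C * N ν))) atTop (nhds 1) := by
  have hC0 : (0 : ℝ) < C := by exact_mod_cast hC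
  have hdefect : ∀ ν, (C : ℝ) - (n ν : ℝ) / N ν =
      gfunDefect C (lam0 ν) / gfun C (lam0 ν) := fun ν => by
    rw [← hlam0 ν, sub_mul_deriv_div_gfun C (hlam0pos ν).le]
  have hlim : Tendsto lam0 atTop atTop := by
    rw [tendsto_atTop]
    intro M
    have hg : 0 < gfun C |M| := one_pos.trans_le (one_le_gfun C (abs_nonneg M))
    have hlt : (C : ℝ) - C / gfun C |M| < C := sub_lt_self _ (by positivity)
    filter_upwards [hratio.eventually_const_lt hlt] with ν hν
    by_contra! hM
    have hpos := hlam0pos ν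
    have hle : (C : ℝ) / gfun C |M| ≤ gfunDefect C (lam0 ν) / gfun C (lam0 ν) :=
      div_le_div₀ (hC0.le.trans (le_gfunDefect hC hpos.le)) (le_gfunDefect hC hpos.le)
        (one_pos.trans_le (one_le_gfun C hpos.le))
        (gfun_le_gfun C hpos.le (hM.le.trans (le_abs_self M)))
    rw [← hdefect ν] at hle
    linarith
  refine ⟨hlim, ?_⟩
  have h := ((tendsto_mul_gfunDefect_div_gfun hC).comp hlim).div_const (C : ℝ)
  rw [div_self hC0.ne'] at h
  refine h.congr fun ν => ?_
  have hN0 : (0 : ℝ) < N ν := by exact_mod_cast hNpos ν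
  rw [Function.comp_apply, mul_div_assoc, ← hdefect ν]
  field_simp
end
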